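/- arXiv:2302.02822 — 2 statements merged into one kernel-verified Lean document; each statement's English description precedes it below -/
import Mathlib

section
/- Every smooth closed plane curve can be decomposed into finitely many embedded arcs: for every smooth closed plane curve α there exists a finite subdivision 0 = t₀ < t₁ < … < t_n = 2π such that α is injective on each interval [t_{i−1}, t_i). -/
open Real Set

/-- A smooth closed plane curve: a C¹ map `ℝ → ℝ²` that is `2π`-periodic and whose
derivative is nonzero everywhere. -/
def IsSmoothClosedCurve (α : ℝ → ℝ × ℝ) : Prop :=
  ContDiff ℝ 1 α ∧ (∀ t : ℝ, α (t + 2 * π) = α t) ∧ ∀ t : ℝ, deriv α t ≠ 0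

/-- A continuous angle lift of the unit tangent vector of `α`. -/
def IsAngleLift (α : ℝ → ℝ × ℝ) (θ : ℝ → ℝ) : Prop :=
  Continuous θ ∧
    ∀ t : ℝ, deriv α t = ‖deriv α t‖ • (Real.cos (θ t), Real.sin (θ t))

/-- `α` has turning number `n` : some continuous angle lift `θ` of the tangent direction
satisfies `θ (2π) - θ 0 = 2πn`. -/
def TurningNumber (α : ℝ → ℝ × ℝ) (n : ℤ) : Prop :=
  ∃ θ : ℝ → ℝ, IsAngleLift α θ ∧ θ (2 * π) - θ 0 = 2 * π * n

/-- `H` is a regular homotopy from `α` to `β`: every time slice is a smooth closed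
plane curve, the endpoints are `α` and `β`, and both `H` and `∂H/∂t` are jointly
continuous on `ℝ × [0,1]`. -/
def IsRegularHomotopy (α β : ℝ → ℝ × ℝ) (H : ℝ → ℝ → ℝ × ℝ) : Prop :=
  (∀ s ∈ Icc (0 : ℝ) 1, IsSmoothClosedCurve fun t => H t s) ∧
  (∀ t, H t 0 = α t) ∧ (∀ t, H t 1 = β t) ∧
  ContinuousOn (fun p : ℝ × ℝ => H p.1 p.2) (univ ×ˢ Icc (0 : ℝ) 1) ∧
  ContinuousOn (fun p : ℝ × ℝ => deriv (fun t => H t p.2) p.1) (univ ×ˢ Icc (0 : ℝ) 1)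

/-- Two curves are regularly homotopic if some regular homotopy connects them. -/
def RegularlyHomotopic (α β : ℝ → ℝ × ℝ) : Prop :=
  ∃ H : ℝ → ℝ → ℝ × ℝ, IsRegularHomotopy α β H

/-- A function with nonzero strict derivative at a point is injective near that point. -/
theorem HasStrictDerivAt.exists_isOpen_injOn {E : Type*} [NormedAddCommGroup E]
    [NormedSpace ℝ E] {f : ℝ → E} {v : E} {a : ℝ} (hf : HasStrictDerivAt f v a) (hv : v ≠ 0) :
    ∃ U : Set ℝ, IsOpen U ∧ a ∈ U ∧ InjOn f U := by
  have hpos : 0 < ‖v‖ := norm_pos_iff.mpr hv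
  have hbound := hf.isLittleO.def (half_pos hpos)
  rw [nhds_prod_eq] at hbound
  obtain ⟨W, hW, hWb⟩ := Filter.mem_prod_self_iff.mp hbound
  obtain ⟨U, hUW, hU, haU⟩ := mem_nhds_iff.mp hW
  refine ⟨U, hU, haU, fun x hx y hy hxy => ?_⟩
  have hle := hWb (Set.mk_mem_prod (hUW hx) (hUW hy))
  simp only [mem_ofPred_eq, hxy, sub_self, zero_sub, norm_neg, ContinuousLinearMap.toSpanSingleton_apply,
    norm_smul] at hle
  by_contra hne
  have : 0 < ‖x - y‖ := norm_pos_iff.mpr (sub_ne_zero.mpr hne)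
  nlinarith

/-- Every smooth closed plane curve can be cut into finitely many embedded arcs:
there is a subdivision `0 = t₀ < t₁ < … < t_n = 2π` such that `α` is injective on
each `[t_{i-1}, t_i)`. -/
theorem exists_subdivision_injOn (α : ℝ → ℝ × ℝ) (hα : IsSmoothClosedCurve α) :
    ∃ (n : ℕ) (t : Fin (n + 1) → ℝ), StrictMono t ∧ t 0 = 0 ∧ t (Fin.last n) = 2 * π ∧
      ∀ i : Fin n, Set.InjOn α (Set.Ico (t i.castSucc) (t i.succ)) := by
  obtain ⟨hsmooth, -, hderiv⟩ := hα
  have hlocal : ∀ a, ∃ U : Set ℝ, IsOpen U ∧ a ∈ U ∧ InjOn α U := fun a =>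
    (hsmooth.contDiffAt.hasStrictDerivAt one_ne_zero).exists_isOpen_injOn (hderiv a)
  obtain ⟨δ, hδ, hball⟩ := lebesgue_number_lemma_of_metric_sUnion
    (isCompact_Icc (a := (0 : ℝ)) (b := 2 * π)) (c := {U | IsOpen U ∧ InjOn α U})
    (fun U hU => hU.1) (fun a _ => by
      obtain ⟨U, hU, haU, hinj⟩ := hlocal a
      exact ⟨U, ⟨hU, hinj⟩, haU⟩)
  obtain ⟨m, hm⟩ := exists_nat_gt (2 * π / δ)
  have hm0 : (0 : ℝ) < m := lt_trans (by positivity) hm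
  have hmesh : 2 * π / m < δ := (div_lt_comm₀ hδ hm0).mp hm
  have hstep : 0 < 2 * π / m := by positivity
  refine ⟨m, fun i => i * (2 * π / m), fun i j hij => ?_, by simp, ?_, fun i => ?_⟩
  · exact mul_lt_mul_of_pos_right (by exact_mod_cast hij) hstep
  · simp only [Fin.val_last]
    field_simp
  · have hi : (i : ℝ) * (2 * π / m) ∈ Icc 0 (2 * π) := by
      refine ⟨by positivity, ?_⟩
      calc (i : ℝ) * (2 * π / m) ≤ m * (2 * π / m) := by
            gcongr
            exact i.isLt.le
        _ = 2 * π := by field_simp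
    obtain ⟨U, ⟨-, hinj⟩, hU⟩ := hball _ hi
    refine hinj.mono fun x hx => hU ?_
    simp only [Fin.val_castSucc, Fin.val_succ, Nat.cast_add, Nat.cast_one, mem_Ico] at hx
    rw [Metric.mem_ball, Real.dist_eq, abs_lt]
    constructor <;> linarith [hx.1, hx.2]
end

section
/- For every twice continuously differentiable smooth closed plane curve α there exists a nonzero vector v ∈ ℝ² such that the set {t ∈ [0, 2π) : ⟨α′(t), v⟩ = 0} of points where the tangent to α is perpendicular to the direction of v is finite. -/
open Real Set

/-- The values taken by a real function at points where its derivative vanishes do not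
exhaust `ℝ`. -/
theorem exists_notMem_image_of_hasDerivAt_zero (f : ℝ → ℝ) :
    ∃ c : ℝ, c ∉ f '' {t | HasDerivAt f 0 t} := by
  have hnull : MeasureTheory.volume (f '' {t | HasDerivAt f 0 t}) = 0 :=
    MeasureTheory.addHaar_image_eq_zero_of_det_fderivWithin_eq_zero MeasureTheory.volume
      (f' := fun _ => 0)
      (fun t ht => by simpa using (HasDerivAt.hasFDerivAt ht).hasFDerivWithinAt)
      (fun _ _ => by simp [ContinuousLinearMap.det])
  by_contra! h
  rw [Set.eq_univ_of_forall h] at hnull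
  simp at hnull

/-- A differentiable function all of whose zeros are simple has finitely many zeros in a
compact set. -/
theorem IsCompact.finite_zeros_of_deriv_ne_zero {K : Set ℝ} (hK : IsCompact K) {g : ℝ → ℝ}
    (hg : Differentiable ℝ g) (hsimple : ∀ t, g t = 0 → deriv g t ≠ 0) :
    {t ∈ K | g t = 0}.Finite := by
  by_contra hinf
  obtain ⟨a, -, ha⟩ :=
    Set.Infinite.exists_accPt_of_subset_isCompact hinf hK (fun t ht => ht.1)
  rw [accPt_iff_frequently_nhdsNE] at ha
  have hfreq : ∃ᶠ t in nhdsWithin a {a}ᶜ, g t = 0 := ha.mono fun t ht => ht.2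
  have hzero : g a = 0 :=
    (isClosed_eq hg.continuous continuous_const).mem_of_frequently_of_tendsto
      (s := {t | g t = 0}) (f := id) hfreq (Filter.tendsto_id.mono_left nhdsWithin_le_nhds)
  exact hfreq ((hg a).hasDerivAt.eventually_ne (hsimple a hzero))

/-- For every C² smooth closed plane curve there is a nonzero direction `v` such
that the tangent is perpendicular to `v` at only finitely many parameters in `[0, 2π)`. -/
theorem exists_direction_finite_perpendicular_tangents (α : ℝ → ℝ × ℝ)
    (hα : IsSmoothClosedCurve α) (hα2 : ContDiff ℝ 2 α) :
    ∃ v : ℝ × ℝ, v ≠ 0 ∧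
      Set.Finite {t ∈ Set.Ico (0 : ℝ) (2 * π) |
        (deriv α t).1 * v.1 + (deriv α t).2 * v.2 = 0} := by
  have hdiff : Differentiable ℝ (deriv α) :=
    (contDiff_succ_iff_deriv (n := 1).1 hα2).2.2.differentiable one_ne_zero
  have hx : Differentiable ℝ fun t => (deriv α t).1 := hdiff.fst
  have hy : Differentiable ℝ fun t => (deriv α t).2 := hdiff.snd
  obtain ⟨c, hc⟩ := exists_notMem_image_of_hasDerivAt_zero
    fun t => (deriv α t).2 / (deriv α t).1
  refine ⟨(c, -1), by simp, ?_⟩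
  refine (isCompact_Icc.finite_zeros_of_deriv_ne_zero
    (g := fun t => (deriv α t).1 * c + (deriv α t).2 * (-1))
    ((hx.mul_const c).add (hy.mul_const (-1))) fun t ht hderiv => hc ?_).subset
    fun t ht => ⟨Set.Ico_subset_Icc_self ht.1, ht.2⟩
  have hxt : (deriv α t).1 ≠ 0 := fun h0 =>
    hα.2.2 t (Prod.ext h0 (by simpa [h0] using ht))
  have hyt : (deriv α t).2 = (deriv α t).1 * c := by linarith
  have hadd := ((hx t).hasDerivAt.mul_const c).add ((hy t).hasDerivAt.mul_const (-1))
  have hderiv := hadd.deriv.symm.trans hderiv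
  refine ⟨t, ?_, by simp only [hyt]; field_simp⟩
  refine ((hy t).hasDerivAt.div (hx t).hasDerivAt hxt).congr_deriv ?_
  rw [div_eq_zero_iff]
  left
  rw [hyt]
  linear_combination -(deriv α t).1 * hderiv
end
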